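/- arXiv:1009.2270 — 2 statements merged into one kernel-verified Lean document; each statement's English description precedes it below -/
import Mathlib

section
/- Let I be a database, η a set of active integrity constraints, and E a justified weak repair for ⟨I,η⟩. Then: (1) for every atom a, exactly one of +a and −a belongs to E ∪ ne(I, I∘E); (2) I∘E ⊨ η; and (3) E is founded with respect to ⟨I,η⟩. -/
namespace AICF

/-- Propositional literals over atoms `At`. -/
inductive Lit (At : Type*) where
  | pos : At → Lit At
  | neg : At → Lit At

namespace Lit
variable {At : Type*}

/-- The dual literal. -/
def dual : Lit At → Lit At
  | pos a => neg a
  | neg a => pos a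

/-- The underlying atom of a literal. -/
def atom : Lit At → At
  | pos a => a
  | neg a => a

end Lit

variable {At : Type*}

/-- A database `I` entails a literal. -/
def entails (I : Set At) : Lit At → Prop
  | .pos a => a ∈ I
  | .neg a => a ∉ I

/-- A database entails a set of literals if it entails each member. -/
def entailsSet (I : Set At) (S : Set (Lit At)) : Prop := ∀ L ∈ S, entails I L

/-- Update actions: `+a` (insert) and `−a` (delete). -/
inductive UAct (At : Type*) where
  | add : At → UAct At
  | del : At → UAct At

namespace UAct
variable {At : Type*}

/-- The dual update action. -/
def dual : UAct At → UAct At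
  | add a => del a
  | del a => add a

/-- The underlying atom of an update action. -/
def atom : UAct At → At
  | add a => a
  | del a => a

/-- `lit(+a) = a`, `lit(−a) = not a`. -/
def lit : UAct At → Lit At
  | add a => .pos a
  | del a => .neg a

end UAct

/-- `ua(a) = +a`, `ua(not a) = −a`. -/
def Lit.ua : Lit At → UAct At
  | .pos a => .add a
  | .neg a => .del a

/-- A set of update actions is consistent if it contains no pair `+a, −a`. -/
def consistentActs (U : Set (UAct At)) : Prop :=
  ∀ a : At, ¬ (UAct.add a ∈ U ∧ UAct.del a ∈ U)

/-- `I ∘ U = (I ∪ {a : +a ∈ U}) \ {a : −a ∈ U}`. -/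
def applyActs (I : Set At) (U : Set (UAct At)) : Set At :=
  (I ∪ {a | UAct.add a ∈ U}) \ {a | UAct.del a ∈ U}

/-- The set of no-effect actions `ne(I,R)`. -/
def noEffect (I R : Set At) : Set (UAct At) :=
  UAct.add '' (I ∩ R) ∪ UAct.del '' (I ∪ R)ᶜ

/-- An active integrity constraint: body (literals), head (update actions),
with `lit(α)^D ∈ body` for each `α` in the head. -/
structure AIC (At : Type*) where
  body : Set (Lit At)
  head : Set (UAct At)
  hua : ∀ α ∈ head, (UAct.lit α).dual ∈ body

/-- `I ⊨ r` : `I` does not entail the whole body. -/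
def satAIC (I : Set At) (r : AIC At) : Prop := ¬ entailsSet I r.body

/-- `I ⊨ η`. -/
def satAICs (I : Set At) (η : Set (AIC At)) : Prop := ∀ r ∈ η, satAIC I r

/-- The updatable literals of `r`: `lit(head(r))^D`. -/
def AIC.up (r : AIC At) : Set (Lit At) := (fun α => (UAct.lit α).dual) '' r.head

/-- The non-updatable literals of `r`. -/
def AIC.nup (r : AIC At) : Set (Lit At) := r.body \ r.up

/-- `lit` of a set of update actions. -/
def litSet (U : Set (UAct At)) : Set (Lit At) := UAct.lit '' U

/-- `U` is closed under the aic `r`. -/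
def closedUnder (U : Set (UAct At)) (r : AIC At) : Prop :=
  r.nup ⊆ litSet U → (r.head ∩ U).Nonempty

/-- `U` is closed under the set `η` of aics. -/
def closedUnderSet (U : Set (UAct At)) (η : Set (AIC At)) : Prop :=
  ∀ r ∈ η, closedUnder U r

/-- `U` is a justified action set for `⟨I,η⟩`: `U` is consistent and is a minimal
set of update actions containing `ne(I, I∘U)` and closed under `η`. -/
def justifiedActionSet (I : Set At) (η : Set (AIC At)) (U : Set (UAct At)) : Prop :=
  consistentActs U ∧
  noEffect I (applyActs I U) ⊆ U ∧
  closedUnderSet U η ∧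
  ∀ U' : Set (UAct At),
    noEffect I (applyActs I U) ⊆ U' → closedUnderSet U' η → U' ⊆ U → U' = U

/-- `E` is a justified weak repair for `⟨I,η⟩`. -/
def justifiedWeakRepair (I : Set At) (η : Set (AIC At)) (E : Set (UAct At)) : Prop :=
  ∃ U : Set (UAct At), justifiedActionSet I η U ∧ E = U \ noEffect I (applyActs I U)

/-- `E` is a justified repair for `⟨I,η⟩`. -/
def justifiedRepair (I : Set At) (η : Set (AIC At)) (E : Set (UAct At)) : Prop :=
  justifiedWeakRepair I η E ∧ ∀ E' ⊆ E, satAICs (applyActs I E') η → E' = E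

/-- `U` is a weak repair for `⟨I,η⟩`. -/
def weakRepair (I : Set At) (η : Set (AIC At)) (U : Set (UAct At)) : Prop :=
  consistentActs U ∧
  (UAct.add '' I ∪ UAct.del '' Iᶜ) ∩ U = ∅ ∧
  satAICs (applyActs I U) η

/-- `U` is a repair for `⟨I,η⟩`. -/
def repair (I : Set At) (η : Set (AIC At)) (U : Set (UAct At)) : Prop :=
  weakRepair I η U ∧ ∀ U' ⊆ U, satAICs (applyActs I U') η → U' = U

/-- The update action `α` is founded w.r.t. `⟨I,η⟩` and `U`. -/
def foundedAct (I : Set At) (η : Set (AIC At)) (U : Set (UAct At)) (α : UAct At) : Prop :=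
  ∃ r ∈ η, α ∈ r.head ∧ entailsSet (applyActs I U) r.nup ∧
    ∀ β ∈ r.head \ {α}, entails (applyActs I U) (UAct.lit β).dual

/-- `U` is founded w.r.t. `⟨I,η⟩`. -/
def foundedSet (I : Set At) (η : Set (AIC At)) (U : Set (UAct At)) : Prop :=
  ∀ α ∈ U, foundedAct I η U α

/-- Founded weak repair. -/
def foundedWeakRepair (I : Set At) (η : Set (AIC At)) (U : Set (UAct At)) : Prop :=
  weakRepair I η U ∧ foundedSet I η U

/-- Founded repair. -/
def foundedRepair (I : Set At) (η : Set (AIC At)) (U : Set (UAct At)) : Prop :=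
  repair I η U ∧ foundedSet I η U

/-- An aic is normal if its head has at most one update action. -/
def AIC.normal (r : AIC At) : Prop := r.head.Subsingleton

/-- The normalization `η^n` of a set of aics. -/
def normSet (η : Set (AIC At)) : Set (AIC At) :=
  {s | ∃ r ∈ η, ∃ α ∈ r.head, s.body = r.body ∧ s.head = {α}}

/- ===== disjunctive logic programs ===== -/

/-- A disjunctive logic program rule `a₁|…|a_k ← β`. -/
structure DRule (At : Type*) where
  head : Set At
  body : Set (Lit At)

/-- A rule is simple: no atom occurs twice in it. -/
def DRule.simple (ρ : DRule At) : Prop :=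
  (∀ a ∈ ρ.head, Lit.pos a ∉ ρ.body ∧ Lit.neg a ∉ ρ.body) ∧
  ∀ a : At, ¬ (Lit.pos a ∈ ρ.body ∧ Lit.neg a ∈ ρ.body)

/-- `M'` is a model of the reduct `P^M`. -/
def modelOfReduct (P : Set (DRule At)) (M M' : Set At) : Prop :=
  ∀ ρ ∈ P, (∀ a : At, Lit.neg a ∈ ρ.body → a ∉ M) →
    {a | Lit.pos a ∈ ρ.body} ⊆ M' → (ρ.head ∩ M').Nonempty

/-- `M` is an answer set of `P`: a minimal model of the reduct `P^M`. -/
def answerSet (P : Set (DRule At)) (M : Set At) : Prop :=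
  modelOfReduct P M M ∧ ∀ M' ⊆ M, modelOfReduct P M M' → M' = M

/-- `aic(ρ) = not a₁,…,not a_k, β ⊃ +a₁|…|+a_k`. -/
def aicOfRule (ρ : DRule At) : AIC At :=
  ⟨Lit.neg '' ρ.head ∪ ρ.body, UAct.add '' ρ.head, by
    rintro α ⟨a, ha, rfl⟩
    exact Set.mem_union_left _ ⟨a, ha, rfl⟩⟩

def aicOfProg (P : Set (DRule At)) : Set (AIC At) := aicOfRule '' P

/- ===== revision programming ===== -/

/-- Revision literals `in(a)` and `out(a)`. -/
inductive RLit (At : Type*) where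
  | inn : At → RLit At
  | out : At → RLit At

namespace RLit
variable {At : Type*}
def dual : RLit At → RLit At
  | inn a => out a
  | out a => inn a
def toLit : RLit At → Lit At
  | inn a => .pos a
  | out a => .neg a
def ua : RLit At → UAct At
  | inn a => .add a
  | out a => .del a
end RLit

def consistentRLits (U : Set (RLit At)) : Prop :=
  ∀ a : At, ¬ (RLit.inn a ∈ U ∧ RLit.out a ∈ U)

/-- `I ⊕ U`. -/
def applyRLits (I : Set At) (U : Set (RLit At)) : Set At :=
  (I ∪ {a | RLit.inn a ∈ U}) \ {a | RLit.out a ∈ U}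

/-- A database satisfies a revision literal. -/
def satR (I : Set At) : RLit At → Prop
  | .inn a => a ∈ I
  | .out a => a ∉ I

/-- A revision rule `α₁|…|α_k ← β₁,…,β_m` with `k+m ≥ 1`. -/
structure RRule (At : Type*) where
  head : Set (RLit At)
  body : Set (RLit At)
  hne : (head ∪ body).Nonempty

/-- `I` satisfies a revision rule. -/
def satRRule (I : Set At) (r : RRule At) : Prop :=
  (∀ β ∈ r.body, satR I β) → ∃ α ∈ r.head, satR I α

def satRProg (I : Set At) (P : Set (RRule At)) : Prop := ∀ r ∈ P, satRRule I r

/-- The inertia set `I(I,R)`. -/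
def inertia (I R : Set At) : Set (RLit At) :=
  RLit.inn '' (I ∩ R) ∪ RLit.out '' (I ∪ R)ᶜ

/-- A revision literal viewed as a revision rule with singleton head and empty body. -/
def RLit.toRule (α : RLit At) : RRule At := ⟨{α}, ∅, by simp⟩

def weakRevision (P : Set (RRule At)) (I : Set At) (U : Set (RLit At)) : Prop :=
  consistentRLits U ∧ U ∩ inertia I (applyRLits I U) = ∅ ∧ satRProg (applyRLits I U) P

def revision (P : Set (RRule At)) (I : Set At) (U : Set (RLit At)) : Prop :=
  weakRevision P I U ∧ ∀ U' ⊆ U, satRProg (applyRLits I U') P → U' = U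

/-- `U` is closed under a revision program. -/
def closedRev (U : Set (RLit At)) (P : Set (RRule At)) : Prop :=
  ∀ r ∈ P, r.body ⊆ U → (r.head ∩ U).Nonempty

/-- `U` is a P-justified update for `I`: a consistent minimal set closed under
`P ∪ I(I, I⊕U)`. -/
def justifiedUpdate (P : Set (RRule At)) (I : Set At) (U : Set (RLit At)) : Prop :=
  consistentRLits U ∧
  closedRev U (P ∪ RLit.toRule '' inertia I (applyRLits I U)) ∧
  ∀ U' ⊆ U, closedRev U' (P ∪ RLit.toRule '' inertia I (applyRLits I U)) → U' = U

def justifiedWeakRevision (P : Set (RRule At)) (I : Set At) (E : Set (RLit At)) : Prop :=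
  ∃ U : Set (RLit At), justifiedUpdate P I U ∧ E = U \ inertia I (applyRLits I U)

def justifiedRevision (P : Set (RRule At)) (I : Set At) (E : Set (RLit At)) : Prop :=
  justifiedWeakRevision P I E ∧ ∀ E' ⊆ E, satRProg (applyRLits I E') P → E' = E

def foundedRLit (P : Set (RRule At)) (I : Set At) (E : Set (RLit At)) (α : RLit At) : Prop :=
  ∃ r ∈ P, α ∈ r.head ∧ (∀ β ∈ r.body, satR (applyRLits I E) β) ∧
    ∀ β ∈ r.head \ {α}, satR (applyRLits I E) β.dual

def foundedRevSet (P : Set (RRule At)) (I : Set At) (E : Set (RLit At)) : Prop :=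
  ∀ α ∈ E, foundedRLit P I E α

def foundedWeakRevision (P : Set (RRule At)) (I : Set At) (E : Set (RLit At)) : Prop :=
  weakRevision P I E ∧ foundedRevSet P I E

def foundedRevision (P : Set (RRule At)) (I : Set At) (E : Set (RLit At)) : Prop :=
  revision P I E ∧ foundedRevSet P I E

/-- A revision program is normal if every head has at most one literal. -/
def normalRProg (P : Set (RRule At)) : Prop := ∀ r ∈ P, r.head.Subsingleton

/-- `head(P_R)`: heads of the rules of `P` whose bodies are satisfied by `R`. -/
def headsOfFired (P : Set (RRule At)) (R : Set At) : Set (RLit At) :=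
  {α | ∃ r ∈ P, (∀ β ∈ r.body, satR R β) ∧ α ∈ r.head}

def supportedUpdate (P : Set (RRule At)) (I : Set At) (U : Set (RLit At)) : Prop :=
  consistentRLits U ∧ U = headsOfFired P (applyRLits I U)

def supportedRevision (P : Set (RRule At)) (I : Set At) (E : Set (RLit At)) : Prop :=
  ∃ U : Set (RLit At), supportedUpdate P I U ∧ E = U \ inertia I (applyRLits I U)

/-- A revision program is proper: no head literal is dual of a body literal. -/
def properRProg (P : Set (RRule At)) : Prop :=
  ∀ r ∈ P, ∀ α ∈ r.head, α.dual ∉ r.body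

/-- `AIC(r)` for a revision rule `r`. -/
def AICofRRule (r : RRule At) : AIC At :=
  ⟨RLit.toLit '' r.body ∪ (fun α => (RLit.toLit α).dual) '' r.head,
   RLit.ua '' r.head, by
    rintro α ⟨β, hβ, rfl⟩
    refine Set.mem_union_right _ ⟨β, hβ, ?_⟩
    cases β <;> rfl⟩

def AICofProg (P : Set (RRule At)) : Set (AIC At) := AICofRRule '' P

/-- `ua` extended to sets of revision literals. -/
def uaSet (E : Set (RLit At)) : Set (UAct At) := RLit.ua '' E

/- ===== shifting ===== -/

open Classical in
/-- `T_W` on update actions. -/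
noncomputable def TWu (W : Set At) (α : UAct At) : UAct At :=
  if α.atom ∈ W then α.dual else α

open Classical in
/-- `T_W` on literals. -/
noncomputable def TWl (W : Set At) (L : Lit At) : Lit At :=
  if L.atom ∈ W then L.dual else L

lemma TW_lit_dual (W : Set At) (α : UAct At) :
    (UAct.lit (TWu W α)).dual = TWl W ((UAct.lit α).dual) := by
  unfold TWu TWl
  by_cases h : α.atom ∈ W <;> cases α <;>
    simp_all [UAct.dual, UAct.lit, UAct.atom, Lit.dual, Lit.atom]

/-- `T_W` on active integrity constraints. -/
noncomputable def TWaic (W : Set At) (r : AIC At) : AIC At :=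
  ⟨TWl W '' r.body, TWu W '' r.head, by
    rintro α ⟨β, hβ, rfl⟩
    rw [TW_lit_dual]
    exact ⟨_, r.hua β hβ, rfl⟩⟩

/-- A database entails an update action: `+a` iff `a ∈ I`, `−a` iff `a ∉ I`. -/
def entailsU (I : Set At) : UAct At → Prop
  | .add a => a ∈ I
  | .del a => a ∉ I

lemma mem_iff_entails_aux {At : Type*} (I : Set At) (U : Set (UAct At))
    (hc : consistentActs U) (hne : noEffect I (applyActs I U) ⊆ U) (α : UAct At) :
    α ∈ U ↔ entails (applyActs I U) α.lit := by
  have key : ∀ a, (UAct.add a ∈ U ↔ a ∈ applyActs I U) ∧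
      (UAct.del a ∈ U ↔ a ∉ applyActs I U) := by
    intro a
    have h1 := hc a
    have h2 : a ∈ I → a ∈ applyActs I U → UAct.add a ∈ U := fun h h' =>
      hne (Or.inl ⟨a, ⟨h, h'⟩, rfl⟩)
    have h3 : a ∉ I → a ∉ applyActs I U → UAct.del a ∈ U := fun h h' =>
      hne (Or.inr ⟨a, fun h'' => h''.elim h h', rfl⟩)
    have h4 : a ∈ applyActs I U ↔ (a ∈ I ∨ UAct.add a ∈ U) ∧ UAct.del a ∉ U := Iff.rfl
    tauto
  cases α with
  | add a => exact (key a).1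
  | del a => exact (key a).2

lemma add_mem_noEffect_aux {At : Type*} (I R : Set At) (a : At) :
    UAct.add a ∈ noEffect I R ↔ a ∈ I ∧ a ∈ R := by
  simp [noEffect]

lemma del_mem_noEffect_aux {At : Type*} (I R : Set At) (a : At) :
    UAct.del a ∈ noEffect I R ↔ a ∉ I ∧ a ∉ R := by
  simp [noEffect]

lemma entails_dual_aux {At : Type*} (R : Set At) (L : Lit At) :
    entails R L.dual ↔ ¬ entails R L := by
  cases L <;> simp [entails, Lit.dual]

lemma exists_lit_aux {At : Type*} (L : Lit At) : ∃ α : UAct At, α.lit = L := by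
  cases L with
  | pos a => exact ⟨.add a, rfl⟩
  | neg a => exact ⟨.del a, rfl⟩

theorem statement4 {At : Type*} [Fintype At] (I : Set At) (η : Set (AIC At))
    (E : Set (UAct At)) (hE : justifiedWeakRepair I η E) :
    (∀ a : At, Xor' (UAct.add a ∈ E ∪ noEffect I (applyActs I E))
        (UAct.del a ∈ E ∪ noEffect I (applyActs I E))) ∧
    satAICs (applyActs I E) η ∧
    foundedSet I η E := by
  obtain ⟨U, ⟨hc, hne, hcl, hmin⟩, hEU⟩ := hE
  have hm := mem_iff_entails_aux I U hc hne
  have hR : applyActs I E = applyActs I U := by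
    ext a
    have h1 := hm (.add a)
    have h2 := hm (.del a)
    have h3 := add_mem_noEffect_aux I (applyActs I U) a
    have h4 := del_mem_noEffect_aux I (applyActs I U) a
    have h5 : UAct.add a ∈ E ↔ UAct.add a ∈ U ∧ UAct.add a ∉ noEffect I (applyActs I U) := by
      rw [hEU]; rfl
    have h6 : UAct.del a ∈ E ↔ UAct.del a ∈ U ∧ UAct.del a ∉ noEffect I (applyActs I U) := by
      rw [hEU]; rfl
    have h7 : a ∈ applyActs I E ↔ (a ∈ I ∨ UAct.add a ∈ E) ∧ UAct.del a ∉ E := Iff.rfl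
    simp only [UAct.lit, entails] at h1 h2
    tauto
  have hU : E ∪ noEffect I (applyActs I U) = U := by
    rw [hEU]; exact Set.diff_union_of_subset hne
  rw [foundedSet, hR, hU]
  refine ⟨?_, ?_, ?_⟩
  · intro a
    have h1 := hm (.add a)
    have h2 := hm (.del a)
    simp only [UAct.lit, entails] at h1 h2
    rw [h1, h2]
    unfold Xor'
    tauto
  · intro r hr hb
    have hn : r.nup ⊆ litSet U := by
      intro L hL
      obtain ⟨α, rfl⟩ := exists_lit_aux L
      exact ⟨α, (hm α).2 (hb _ hL.1), rfl⟩
    obtain ⟨α, hα, hαU⟩ := hcl r hr hn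
    exact (entails_dual_aux _ _).1 (hb _ (r.hua α hα)) ((hm α).1 hαU)
  · intro α hα
    have hα' : α ∈ U ∧ α ∉ noEffect I (applyActs I U) := by
      rw [hEU] at hα; exact hα
    have hnc : ¬ closedUnderSet (U \ {α}) η := by
      intro h
      have := hmin (U \ {α}) (fun β hβ => ⟨hne hβ, fun h' => hα'.2 (h' ▸ hβ)⟩) h
        Set.diff_subset
      have h2 := hα'.1
      rw [← this] at h2
      exact h2.2 rfl
    unfold closedUnderSet closedUnder at hnc
    push Not at hnc
    obtain ⟨r, hr, hn, hh⟩ := hnc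
    have hout : ∀ β ∈ r.head, β ∈ U → β = α := by
      intro β hβ hβU
      by_contra hne'
      have : β ∈ r.head ∩ (U \ {α}) := ⟨hβ, hβU, hne'⟩
      rw [hh] at this
      exact this
    have hn' : r.nup ⊆ litSet U := hn.trans (Set.image_mono Set.diff_subset)
    obtain ⟨γ, hγ, hγU⟩ := hcl r hr hn'
    refine ⟨r, hr, hout γ hγ hγU ▸ hγ, ?_, ?_⟩
    · rw [hR]
      intro L hL
      obtain ⟨β, hβ, rfl⟩ := hn' hL
      exact (hm β).1 hβ
    · rw [hR]
      intro β hβ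
      rw [entails_dual_aux, ← hm]
      exact fun h => hβ.2 (hout β hβ.1 h)

end AICF
end

section
/- Let I be a database, η a set of active integrity constraints, and E a justified repair for ⟨I,η⟩. Then E is a founded repair for ⟨I,η⟩. -/
namespace AICF

variable {At : Type*}

theorem mem_iff_of_just (I : Set At) (U : Set (UAct At)) (hc : consistentActs U)
    (hn : noEffect I (applyActs I U) ⊆ U) (α : UAct At) :
    α ∈ U ↔ entails (applyActs I U) α.lit := by
  cases α with
  | add a =>
    constructor
    · intro h
      exact ⟨Or.inr h, fun h' => hc a ⟨h, h'⟩⟩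
    · rintro h
      by_cases hI : a ∈ I
      · exact hn (Or.inl ⟨a, ⟨hI, h⟩, rfl⟩)
      · exact h.1.resolve_left hI
  | del a =>
    constructor
    · intro h h'
      exact h'.2 h
    · intro h
      by_contra hd
      by_cases hI : a ∈ I
      · exact h ⟨Or.inl hI, hd⟩
      · exact hd (hn (Or.inr ⟨a, fun h' => h'.elim hI h, rfl⟩))

theorem entails_lit_dual (R : Set At) (α : UAct At) :
    entails R α.lit.dual ↔ ¬ entails R α.lit := by
  cases α <;> simp [UAct.lit, Lit.dual, entails]

theorem lit_mem_litSet (R : Set At) (U : Set (UAct At))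
    (h : ∀ α : UAct At, α ∈ U ↔ entails R α.lit) (L : Lit At) :
    L ∈ litSet U ↔ entails R L := by
  constructor
  · rintro ⟨α, hα, rfl⟩
    exact (h α).1 hα
  · intro hL
    cases L with
    | pos a => exact ⟨.add a, (h _).2 hL, rfl⟩
    | neg a => exact ⟨.del a, (h _).2 hL, rfl⟩

theorem apply_diff (I : Set At) (U : Set (UAct At)) (hc : consistentActs U) :
    applyActs I (U \ noEffect I (applyActs I U)) = applyActs I U := by
  ext a
  have hca := hc a
  by_cases h1 : a ∈ I <;> by_cases h2 : UAct.add a ∈ U <;> by_cases h3 : UAct.del a ∈ U <;>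
    simp_all [applyActs, noEffect]

theorem statement6 {At : Type*} [Fintype At] (I : Set At) (η : Set (AIC At))
    (E : Set (UAct At)) (hE : justifiedRepair I η E) :
    foundedRepair I η E := by
  obtain ⟨⟨U, ⟨hc, hn, hcl, hmin⟩, rfl⟩, hm⟩ := hE
  have hU := mem_iff_of_just I U hc hn
  have hL := lit_mem_litSet (applyActs I U) U hU
  refine ⟨⟨⟨fun a h => hc a ⟨h.1.1, h.2.1⟩, ?_, ?_⟩, hm⟩, ?_⟩
  · ext α
    simp only [Set.mem_inter_iff, Set.mem_empty_iff_false, iff_false]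
    rintro ⟨⟨a, ha, rfl⟩ | ⟨a, ha, rfl⟩, h, h'⟩
    · exact h' (Or.inl ⟨a, ⟨ha, (hU _).1 h⟩, rfl⟩)
    · exact h' (Or.inr ⟨a, fun k => k.elim ha ((hU _).1 h), rfl⟩)
  · rw [apply_diff I U hc]
    intro r hr hb
    obtain ⟨α, hα, hαU⟩ := hcl r hr (fun L h => (hL L).2 (hb L h.1))
    exact (entails_lit_dual _ α).1 (hb _ (r.hua α hα)) ((hU α).1 hαU)
  · rintro α ⟨hαU, hαn⟩
    have hnc : ¬ closedUnderSet (U \ {α}) η := by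
      intro h
      have := hmin (U \ {α}) (fun β hβ => ⟨hn hβ, fun e => hαn (e ▸ hβ)⟩) h Set.sdiff_subset
      rw [← this] at hαU
      exact hαU.2 rfl
    unfold closedUnderSet closedUnder at hnc
    push Not at hnc
    obtain ⟨r, hr, hnup, he⟩ := hnc
    have hnU : r.nup ⊆ litSet U := fun L h => by
      obtain ⟨β, hβ, e⟩ := hnup h
      exact ⟨β, hβ.1, e⟩
    have key : ∀ β ∈ r.head, β ∈ U → β = α := by
      intro β hβ hβU
      by_contra hne
      have : β ∈ r.head ∩ (U \ {α}) := ⟨hβ, hβU, hne⟩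
      rw [he] at this
      exact this
    obtain ⟨γ, hγ, hγU⟩ := hcl r hr hnU
    unfold foundedAct
    rw [apply_diff I U hc]
    refine ⟨r, hr, key γ hγ hγU ▸ hγ, fun L h => (hL L).1 (hnU h), ?_⟩
    rintro β ⟨hβ, hne⟩
    exact (entails_lit_dual _ β).2 fun h => hne (key β hβ ((hU β).2 h))

end AICF
end
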